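/- Let d ≥ 1, let V ⊆ ℝ^d be an open convex cone with vertex at 0 not containing 0, let a > 0, and let U ⊆ ℂ be open. Let g : ℂ × ℂ^d → ℂ be holomorphic on U × W where W = {x + iy ∈ ℂ^d : y ∈ V, ‖y‖ < a}, and suppose that for every compact subset 𝒦 ⊆ U there exist C > 0 and nonnegative integers L, K with |g(w, x+iy)| ≤ C (1 + ‖x‖^2)^L ‖y‖^{-2K} for all w ∈ 𝒦 and x + iy ∈ W. Fix v ∈ V and a Schwartz function f : ℝ^d → ℂ. Then for every w ∈ U the limit h(w) := lim_{ε→0+} ∫_{ℝ^d} g(w, x + iεv) f(x) dx exists and is finite, and the function h is holomorphic on U. -/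

import Mathlib

open MeasureTheory Filter Complex

open scoped Topology LineDeriv SchwartzMap

/-- Differentiation under the integral sign for a family of holomorphic functions with an
integrable dominating function. -/
theorem hasDerivAt_integral_of_holomorphic_of_dominated {α : Type*} [MeasurableSpace α]
    {μ : Measure α} {F : ℂ → α → ℂ} {z₀ : ℂ} {r : ℝ} {bound : α → ℝ} (hr : 0 < r)
    (hmeas : ∀ z ∈ Metric.ball z₀ r, AEStronglyMeasurable (F z) μ)
    (hdiff : ∀ x, DifferentiableOn ℂ (fun z => F z x) (Metric.ball z₀ r))
    (hle : ∀ z ∈ Metric.ball z₀ r, ∀ x, ‖F z x‖ ≤ bound x) (hint : Integrable bound μ) :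
    Integrable (fun x => deriv (fun z => F z x) z₀) μ ∧
      HasDerivAt (fun z => ∫ x, F z x ∂μ) (∫ x, deriv (fun z => F z x) z₀ ∂μ) z₀ := by
  have hat : ∀ x, ∀ z ∈ Metric.ball z₀ r, HasDerivAt (fun z => F z x)
      (deriv (fun z => F z x) z) z := fun x z hz =>
    ((hdiff x).differentiableAt (Metric.isOpen_ball.mem_nhds hz)).hasDerivAt
  have hz₀ : z₀ ∈ Metric.ball z₀ r := Metric.mem_ball_self hr
  refine hasDerivAt_integral_of_dominated_loc_of_deriv_le (s := Metric.ball z₀ (r / 2))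
    (F' := fun z x => deriv (fun z => F z x) z) (bound := fun x => bound x / (r / 3))
    (Metric.ball_mem_nhds _ (by positivity)) ?_ ?_ ?_ ?_ (hint.div_const _) ?_
  · filter_upwards [Metric.ball_mem_nhds z₀ hr] with z hz using hmeas z hz
  · exact hint.mono' (hmeas z₀ hz₀) (Eventually.of_forall (hle z₀ hz₀))
  · have hseq : Tendsto (fun n : ℕ => ((r / 2 : ℝ) : ℂ) * (1 / ((n : ℂ) + 1))) atTop (𝓝 0) := by
      simpa using (tendsto_one_div_add_atTop_nhds_zero_nat (𝕜 := ℂ)).const_mul ((r / 2 : ℝ) : ℂ)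
    have hne : ∀ n : ℕ, ((r / 2 : ℝ) : ℂ) * (1 / ((n : ℂ) + 1)) ≠ 0 := fun n =>
      mul_ne_zero (by exact_mod_cast (by positivity : r / 2 ≠ 0))
        (one_div_ne_zero (by exact_mod_cast n.succ_ne_zero))
    have hmem : ∀ n : ℕ, z₀ + ((r / 2 : ℝ) : ℂ) * (1 / ((n : ℂ) + 1)) ∈ Metric.ball z₀ r := by
      intro n
      have h1 : ‖(1 / ((n : ℂ) + 1))‖ ≤ 1 := by
        rw [norm_div, norm_one, ← Nat.cast_succ, Complex.norm_natCast]
        exact div_le_one_of_le₀ (by simp) (by positivity)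
      have h2 : ‖((r / 2 : ℝ) : ℂ)‖ = r / 2 := by
        rw [Complex.norm_real, Real.norm_of_nonneg (by positivity)]
      rw [mem_ball_iff_norm, add_sub_cancel_left, norm_mul, h2]
      nlinarith
    refine aestronglyMeasurable_of_tendsto_ae atTop
      (f := fun (n : ℕ) x => (((r / 2 : ℝ) : ℂ) * (1 / ((n : ℂ) + 1)))⁻¹ •
        (F (z₀ + ((r / 2 : ℝ) : ℂ) * (1 / ((n : ℂ) + 1))) x - F z₀ x))
      (fun n => ((hmeas _ (hmem n)).sub (hmeas _ hz₀)).const_smul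
        ((((r / 2 : ℝ) : ℂ) * (1 / ((n : ℂ) + 1)))⁻¹))
      (Eventually.of_forall fun x => ?_)
    exact (hasDerivAt_iff_tendsto_slope_zero.1 (hat x z₀ hz₀)).comp
      (tendsto_nhdsWithin_iff.2 ⟨hseq, Eventually.of_forall hne⟩)
  · refine Eventually.of_forall fun x z hz => ?_
    have hsub : Metric.closedBall z (r / 3) ⊆ Metric.ball z₀ r := fun y hy => by
      have := dist_triangle y z z₀
      rw [Metric.mem_ball] at *
      rw [Metric.mem_closedBall] at hy
      linarith
    refine norm_deriv_le_of_forall_mem_sphere_norm_le (by positivity)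
      (DifferentiableOn.diffContOnCl ?_) fun y hy =>
        hle y (hsub (Metric.sphere_subset_closedBall hy)) x
    exact (hdiff x).mono (Metric.closure_ball_subset_closedBall.trans hsub)
  · exact Eventually.of_forall fun x z hz =>
      hat x z (Metric.ball_subset_ball (by linarith) hz)

theorem SchwartzMap.integrable_one_add_norm_pow_mul {E : Type*} [NormedAddCommGroup E]
    [NormedSpace ℝ E] [FiniteDimensional ℝ E] [MeasurableSpace E] [BorelSpace E]
    (μ : Measure E) [μ.IsAddHaarMeasure] (f : 𝓢(E, ℂ)) (N : ℕ) :
    Integrable (fun x => (1 + ‖x‖) ^ N * ‖f x‖) μ := by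
  have h : ∀ x : E, (1 + ‖x‖) ^ N * ‖f x‖ =
      ∑ m ∈ Finset.range (N + 1), (N.choose m : ℝ) * (‖x‖ ^ m * ‖f x‖) := by
    intro x
    rw [add_comm, add_pow, Finset.sum_mul]
    exact Finset.sum_congr rfl fun m _ => by simp; ring
  simp_rw [h]
  exact integrable_finsetSum _ fun m _ => (f.integrable_pow_mul μ m).const_mul _

/-- The Taylor polynomial with moving base point has a telescoping derivative. -/
theorem hasDerivAt_sum_taylor_basePoint {Φ : ℕ → ℝ → ℂ} {t : ℝ}
    (h : ∀ j, HasDerivAt (Φ j) (Φ (j + 1) t) t) (e : ℝ) (n : ℕ) :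
    HasDerivAt
      (fun s => ∑ j ∈ Finset.range (n + 1), (((e - s) ^ j / (j.factorial : ℝ) : ℝ) : ℂ) * Φ j s)
      ((((e - t) ^ n / (n.factorial : ℝ) : ℝ) : ℂ) * Φ (n + 1) t) t := by
  induction n with
  | zero => simpa using h 0
  | succ n ih =>
    simp_rw [Finset.sum_range_succ _ (n + 1)]
    have h1 : HasDerivAt (fun s : ℝ => (e - s) ^ (n + 1) / ((n + 1).factorial : ℝ))
        (-((e - t) ^ n / (n.factorial : ℝ))) t := by
      have := (((hasDerivAt_id t).const_sub e).pow (n + 1)).div_const ((n + 1).factorial : ℝ)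
      refine this.congr_deriv ?_
      have : (n.factorial : ℝ) ≠ 0 := by positivity
      simp [Nat.factorial_succ]
      field_simp
    refine (ih.add (h1.ofReal_comp.mul (h (n + 1)))).congr_deriv ?_
    push_cast
    ring

/-- If a chain of successive derivatives on `(0, δ₀)` has uniform polynomial blow-up at `0`,
then its members are uniformly bounded near `0`. -/
theorem exists_norm_le_of_derivative_chain {ι : Type*} {s : Set ι} {Φ : ℕ → ι → ℝ → ℂ}
    {δ₀ : ℝ} {M : ℕ}
    (hderiv : ∀ w ∈ s, ∀ j, ∀ t ∈ Set.Ioo 0 δ₀, HasDerivAt (Φ j w) (Φ (j + 1) w t) t)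
    (hbound : ∀ j, ∃ B : ℝ, ∀ w ∈ s, ∀ t ∈ Set.Ioo 0 δ₀, ‖Φ j w t‖ ≤ B / t ^ M)
    {δ : ℝ} (hδ : 0 < δ) (hδ₀ : δ < δ₀) :
    ∃ B : ℝ, ∀ w ∈ s, ∀ t ∈ Set.Ioc 0 δ, ‖Φ 0 w t‖ ≤ B := by
  choose B hB using hbound
  refine ⟨∑ j ∈ Finset.range (M + 1), δ ^ j * (B j / δ ^ M) + |B (M + 1)| * δ, ?_⟩
  intro w hw e he
  set ψ : ℝ → ℂ := fun s =>
    ∑ j ∈ Finset.range (M + 1), (((e - s) ^ j / (j.factorial : ℝ) : ℝ) : ℂ) * Φ j w s with hψ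
  have hIoo : ∀ t ∈ Set.Icc e δ, t ∈ Set.Ioo 0 δ₀ := fun t ht =>
    ⟨he.1.trans_le ht.1, ht.2.trans_lt hδ₀⟩
  have hψe : ψ e = Φ 0 w e := by
    simp only [hψ]
    rw [Finset.sum_eq_single 0]
    · simp
    · intro j _ hj
      simp [hj]
    · simp
  have hcoef : ∀ t ∈ Set.Icc e δ, ∀ j : ℕ,
      ‖(((e - t) ^ j / (j.factorial : ℝ) : ℝ) : ℂ)‖ ≤ t ^ j := by
    intro t ht j
    rw [Complex.norm_real, norm_div, norm_pow, Real.norm_natCast]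
    have h1 : ‖e - t‖ ≤ t := by
      rw [Real.norm_eq_abs, abs_le]
      constructor <;> linarith [he.1, ht.1]
    have h2 : (1 : ℝ) ≤ j.factorial := by exact_mod_cast j.factorial_pos
    calc ‖e - t‖ ^ j / j.factorial ≤ ‖e - t‖ ^ j := div_le_self (by positivity) h2
      _ ≤ t ^ j := by gcongr
  have hmvt : ‖ψ e - ψ δ‖ ≤ |B (M + 1)| * ‖e - δ‖ := by
    refine Convex.norm_image_sub_le_of_norm_hasDerivWithin_le (s := Set.Icc e δ)
      (fun t ht => (hasDerivAt_sum_taylor_basePoint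
        (fun j => hderiv w hw j t (hIoo t ht)) e M).hasDerivWithinAt)
      ?_ (convex_Icc e δ) ⟨he.2, le_rfl⟩ ⟨le_rfl, he.2⟩
    intro t ht
    have ht0 := (hIoo t ht).1
    rw [norm_mul]
    calc _ ≤ t ^ M * (|B (M + 1)| / t ^ M) := by
          gcongr
          · exact hcoef t ht M
          · refine (hB (M + 1) w hw t (hIoo t ht)).trans ?_
            gcongr
            exact le_abs_self _
      _ = |B (M + 1)| := by field_simp
  have hψδ : ‖ψ δ‖ ≤ ∑ j ∈ Finset.range (M + 1), δ ^ j * (B j / δ ^ M) := by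
    refine (norm_sum_le _ _).trans (Finset.sum_le_sum fun j _ => ?_)
    rw [norm_mul]
    gcongr
    · exact hcoef δ ⟨he.2, le_rfl⟩ j
    · exact hB j w hw δ ⟨hδ, hδ₀⟩
  have hd : ‖e - δ‖ ≤ δ := by
    rw [Real.norm_eq_abs, abs_le]
    constructor <;> linarith [he.1, he.2]
  calc ‖Φ 0 w e‖ = ‖ψ δ + (ψ e - ψ δ)‖ := by rw [← hψe]; congr 1; ring
    _ ≤ _ := (norm_add_le _ _).trans
      (add_le_add hψδ (hmvt.trans (mul_le_mul_of_nonneg_left hd (abs_nonneg _))))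

theorem exists_lipschitz_of_derivative_chain {ι : Type*} {s : Set ι} {Φ : ℕ → ι → ℝ → ℂ}
    {δ₀ : ℝ} {M : ℕ}
    (hderiv : ∀ w ∈ s, ∀ j, ∀ t ∈ Set.Ioo 0 δ₀, HasDerivAt (Φ j w) (Φ (j + 1) w t) t)
    (hbound : ∀ j, ∃ B : ℝ, ∀ w ∈ s, ∀ t ∈ Set.Ioo 0 δ₀, ‖Φ j w t‖ ≤ B / t ^ M)
    {δ : ℝ} (hδ : 0 < δ) (hδ₀ : δ < δ₀) :
    ∃ B : ℝ, ∀ w ∈ s, ∀ t ∈ Set.Ioc 0 δ, ∀ t' ∈ Set.Ioc 0 δ,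
      ‖Φ 0 w t - Φ 0 w t'‖ ≤ B * |t - t'| := by
  obtain ⟨B, hB⟩ := exists_norm_le_of_derivative_chain (Φ := fun j => Φ (j + 1))
    (fun w hw j => hderiv w hw (j + 1)) (fun j => hbound (j + 1)) hδ hδ₀
  refine ⟨B, fun w hw t ht t' ht' => ?_⟩
  exact Convex.norm_image_sub_le_of_norm_hasDerivWithin_le
    (fun u hu => (hderiv w hw 0 u ⟨hu.1, hu.2.trans_lt hδ₀⟩).hasDerivWithinAt)
    (fun u hu => hB w hw u hu) (convex_Ioc 0 δ) ht' ht

/-- A family of holomorphic functions that is Lipschitz in its real parameter, uniformly on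
compact sets, has a holomorphic limit as the parameter tends to `0` from the right. -/
theorem exists_holomorphic_limit_of_lipschitz {U : Set ℂ} (hU : IsOpen U) {F : ℝ → ℂ → ℂ}
    {δ : ℝ} (hδ : 0 < δ) (hF : ∀ t ∈ Set.Ioc 0 δ, DifferentiableOn ℂ (F t) U)
    (hlip : ∀ K ⊆ U, IsCompact K → ∃ B : ℝ, ∀ w ∈ K, ∀ t ∈ Set.Ioc 0 δ, ∀ t' ∈ Set.Ioc 0 δ,
      ‖F t w - F t' w‖ ≤ B * |t - t'|) :
    ∃ h : ℂ → ℂ, (∀ w ∈ U, Tendsto (fun t => F t w) (𝓝[>] 0) (𝓝 (h w))) ∧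
      DifferentiableOn ℂ h U := by
  have hIoc : Set.Ioc 0 δ ∈ 𝓝[>] (0 : ℝ) := Ioc_mem_nhdsGT hδ
  have hex : ∀ w ∈ U, ∃ c, Tendsto (fun t => F t w) (𝓝[>] 0) (𝓝 c) := by
    intro w hw
    obtain ⟨B, hB⟩ := hlip {w} (by simpa using hw) isCompact_singleton
    refine cauchy_map_iff_exists_tendsto.1 (Metric.cauchy_iff.2 ⟨inferInstance, fun e he => ?_⟩)
    have hpos : 0 < min δ (e / (|B| + 1)) := by positivity
    refine ⟨_, image_mem_map (Ioc_mem_nhdsGT hpos), ?_⟩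
    rintro _ ⟨t, ht, rfl⟩ _ ⟨t', ht', rfl⟩
    have hle : |t - t'| < e / (|B| + 1) := by
      have h1 := ht.2.trans (min_le_right _ _)
      have h2 := ht'.2.trans (min_le_right _ _)
      rw [abs_lt]
      constructor <;> linarith [ht.1, ht'.1]
    rw [dist_eq_norm]
    calc _ ≤ B * |t - t'| := hB w rfl t ⟨ht.1, ht.2.trans (min_le_left _ _)⟩ t'
            ⟨ht'.1, ht'.2.trans (min_le_left _ _)⟩
      _ ≤ (|B| + 1) * |t - t'| := by gcongr; linarith [le_abs_self B]
      _ < (|B| + 1) * (e / (|B| + 1)) := by gcongr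
      _ = e := by field_simp
  choose! h hh using hex
  refine ⟨h, hh, ?_⟩
  refine TendstoLocallyUniformlyOn.differentiableOn (F := F) (φ := 𝓝[>] (0 : ℝ)) ?_
    (by filter_upwards [hIoc] with t ht using hF t ht) hU
  rw [tendstoLocallyUniformlyOn_iff_forall_isCompact hU]
  intro K hK hKc
  obtain ⟨B, hB⟩ := hlip K hK hKc
  rw [Metric.tendstoUniformlyOn_iff]
  intro e he
  have hpos : 0 < min δ (e / (|B| + 1)) := by positivity
  filter_upwards [Ioo_mem_nhdsGT hpos] with t ht w hw
  have htδ : t ∈ Set.Ioc 0 δ := ⟨ht.1, (ht.2.trans_le (min_le_left _ _)).le⟩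
  have hlim : dist (h w) (F t w) ≤ B * |0 - t| := by
    refine le_of_tendsto_of_tendsto ((hh w (hK hw)).dist tendsto_const_nhds)
      (g := fun t' => B * |t' - t|) ?_ ?_
    · exact tendsto_nhdsWithin_of_tendsto_nhds
        (Continuous.tendsto' (by fun_prop) _ _ rfl)
    · filter_upwards [hIoc] with t' ht'
      rw [dist_eq_norm]
      exact hB w hw t' ht' t htδ
  rw [zero_sub, abs_neg, abs_of_pos ht.1] at hlim
  have ht2 : t < e / (|B| + 1) := ht.2.trans_le (min_le_right _ _)
  rw [lt_div_iff₀ (by positivity)] at ht2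
  nlinarith [le_abs_self B, ht.1]

/-- Moving the imaginary part of a holomorphic function of slow growth, tested against a Schwartz
function, amounts to differentiating the test function. -/
theorem hasDerivAt_integral_mul_schwartz_of_strip {E : Type*} [NormedAddCommGroup E]
    [NormedSpace ℝ E] [FiniteDimensional ℝ E] [MeasurableSpace E] [BorelSpace E]
    {μ : Measure E} [μ.IsAddHaarMeasure] {v : E} {δ C : ℝ} {N M : ℕ} {G : E → ℂ → ℂ}
    (hshift : ∀ x ζ (t : ℝ), G (x + t • v) ζ = G x (ζ + t))
    (hcont : ∀ ζ : ℂ, ζ.im ∈ Set.Ioo 0 δ → Continuous fun x => G x ζ)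
    (hdiff : ∀ x, DifferentiableOn ℂ (G x) {ζ | ζ.im ∈ Set.Ioo 0 δ})
    (hC : 0 ≤ C)
    (hbound : ∀ x (ζ : ℂ), ζ.im ∈ Set.Ioo 0 δ →
      ‖G x ζ‖ ≤ C * (1 + ‖x + ζ.re • v‖) ^ N / ζ.im ^ M)
    (f : 𝓢(E, ℂ)) {e : ℝ} (he : e ∈ Set.Ioo 0 δ) :
    HasDerivAt (fun t : ℝ => ∫ x, G x (t * I) * f x ∂μ)
      (∫ x, G x (e * I) * ((-I) • ∂_{v} f : 𝓢(E, ℂ)) x ∂μ) e := by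
  have he0 : 0 < e := he.1
  set r : ℝ := min (e / 2) (δ - e)
  have hr0 : 0 < r := lt_min (by linarith) (by linarith [he.2])
  have hball : ∀ ζ ∈ Metric.ball ((e : ℂ) * I) r,
      |ζ.re| ≤ e ∧ e / 2 ≤ ζ.im ∧ ζ.im ∈ Set.Ioo 0 δ := by
    intro ζ hζ
    rw [mem_ball_iff_norm] at hζ
    have h1 := (abs_re_le_norm _).trans_lt hζ
    have h2 := (abs_im_le_norm _).trans_lt hζ
    simp at h1 h2
    have h3 := h2.trans_le (min_le_left _ _)
    have h4 := h2.trans_le (min_le_right _ _)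
    have h5 := h1.trans_le (min_le_left _ _)
    rw [abs_lt] at h3 h4
    exact ⟨by linarith, by linarith, by linarith, by linarith⟩
  have hmem : (e : ℂ) * I ∈ Metric.ball ((e : ℂ) * I) r := Metric.mem_ball_self hr0
  have hIm : ((e : ℂ) * I).im ∈ Set.Ioo 0 δ := (hball _ hmem).2.2
  have hle : ∀ φ : 𝓢(E, ℂ), ∀ ζ ∈ Metric.ball ((e : ℂ) * I) r, ∀ x, ‖G x ζ * φ x‖ ≤
      C * (1 + e * ‖v‖) ^ N / (e / 2) ^ M * ((1 + ‖x‖) ^ N * ‖φ x‖) := by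
    intro φ ζ hζ x
    obtain ⟨h1, h2, h3⟩ := hball ζ hζ
    have h4 : 1 + ‖x + ζ.re • v‖ ≤ (1 + e * ‖v‖) * (1 + ‖x‖) := by
      have h5 := norm_add_le x (ζ.re • v)
      rw [norm_smul, Real.norm_eq_abs] at h5
      have h6 : |ζ.re| * ‖v‖ ≤ e * ‖v‖ := by gcongr
      have : 0 ≤ e * ‖v‖ * ‖x‖ := by positivity
      nlinarith
    have h7 : ‖G x ζ‖ ≤ C * ((1 + e * ‖v‖) * (1 + ‖x‖)) ^ N / (e / 2) ^ M :=
      (hbound x ζ h3).trans (by gcongr)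
    rw [norm_mul]
    calc _ ≤ C * ((1 + e * ‖v‖) * (1 + ‖x‖)) ^ N / (e / 2) ^ M * ‖φ x‖ := by gcongr
      _ = _ := by rw [mul_pow]; ring
  have hint : ∀ φ : 𝓢(E, ℂ), Integrable (fun x =>
      C * (1 + e * ‖v‖) ^ N / (e / 2) ^ M * ((1 + ‖x‖) ^ N * ‖φ x‖)) μ :=
    fun φ => (φ.integrable_one_add_norm_pow_mul μ N).const_mul _
  have hmeas : ∀ φ : 𝓢(E, ℂ), ∀ ζ ∈ Metric.ball ((e : ℂ) * I) r,
      AEStronglyMeasurable (fun x => G x ζ * φ x) μ := fun φ ζ hζ =>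
    ((hcont ζ (hball ζ hζ).2.2).mul φ.continuous).aestronglyMeasurable
  have hGat : ∀ x, HasDerivAt (G x) (deriv (G x) (e * I)) (e * I) := fun x =>
    ((hdiff x).mono fun ζ hζ => (hball ζ hζ).2.2).differentiableAt
      (Metric.ball_mem_nhds _ hr0) |>.hasDerivAt
  have hGd : ∀ x, deriv (fun ζ => G x ζ * f x) (e * I) = deriv (G x) (e * I) * f x := fun x =>
    ((hGat x).mul_const _).deriv
  obtain ⟨hI, hD⟩ := hasDerivAt_integral_of_holomorphic_of_dominated hr0 (hmeas f)
    (fun x => ((hdiff x).mono fun ζ hζ => (hball ζ hζ).2.2).mul_const _) (hle f) (hint f)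
  simp_rw [hGd] at hI hD
  have hparts := integral_bilinear_hasLineDerivAt_right_eq_neg_left_of_integrable (μ := μ)
    (f := fun x => G x (e * I)) (f' := fun x => deriv (G x) (e * I)) (g := f)
    (g' := (∂_{v} f : 𝓢(E, ℂ))) (v := v) (B := ContinuousLinearMap.mul ℝ ℂ)
    hI ((hint _).mono' (hmeas _ _ hmem) (Eventually.of_forall (hle (∂_{v} f) _ hmem)))
    ((hint _).mono' (hmeas _ _ hmem) (Eventually.of_forall (hle f _ hmem)))
    (fun x _ => ?_) (fun x _ => ?_)
  · have hD' : HasDerivAt (fun t : ℝ => ∫ x, G x (t * I) * f x ∂μ)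
        ((∫ x, deriv (G x) (e * I) * f x ∂μ) * I) e := by
      have h1 : HasDerivAt (fun t : ℝ => (t : ℂ) * I) I e := by
        simpa using (hasDerivAt_id e).ofReal_comp.mul_const I
      exact hD.comp e h1
    refine hD'.congr_deriv ?_
    simp only [ContinuousLinearMap.mul_apply'] at hparts
    rw [← neg_eq_iff_eq_neg] at hparts
    rw [← hparts, ← integral_neg, ← integral_mul_const]
    refine integral_congr_ae (Eventually.of_forall fun x => ?_)
    simp
    ring
  · unfold HasLineDerivAt
    simp_rw [hshift]
    have h1 : HasDerivAt (fun t : ℝ => (e : ℂ) * I + t) 1 0 := by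
      simpa using (hasDerivAt_id (0 : ℝ)).ofReal_comp.const_add ((e : ℂ) * I)
    have h2 : HasDerivAt (G x) (deriv (G x) (e * I)) ((e : ℂ) * I + (0 : ℝ)) := by
      simpa using hGat x
    have h3 := HasDerivAt.comp (h := fun t : ℝ => (e : ℂ) * I + t) 0 h2 h1
    rw [mul_one] at h3
    exact h3
  · rw [SchwartzMap.lineDerivOp_apply_eq_fderiv]
    exact f.differentiableAt.hasFDerivAt.hasLineDerivAt v

/-- The Euclidean square norm plus one is controlled by the sup norm. -/
theorem one_add_sum_sq_le {d : ℕ} (x : Fin d → ℝ) :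
    1 + ∑ k, x k ^ 2 ≤ (1 + d) * (1 + ‖x‖) ^ 2 := by
  have h1 : ∑ k, x k ^ 2 ≤ d * ‖x‖ ^ 2 := by
    calc ∑ k, x k ^ 2 ≤ ∑ _k : Fin d, ‖x‖ ^ 2 := Finset.sum_le_sum fun k _ => by
          rw [← sq_abs, ← Real.norm_eq_abs]
          gcongr
          exact norm_le_pi_norm x k
      _ = d * ‖x‖ ^ 2 := by simp
  have h2 : 0 ≤ (d : ℝ) * ‖x‖ := by positivity
  have h3 : (0 : ℝ) ≤ d := by positivity
  nlinarith [norm_nonneg x, sq_nonneg ‖x‖]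

/-- **Holomorphic dependence of the boundary value on an extra parameter.**
Let `g(w, u)` be holomorphic on `U × W` where `W` is a tube over an open convex cone `V`,
with a slow-growth bound uniform on compact subsets of `U`. Then for fixed `v ∈ V` and
Schwartz `f`, the boundary value `h(w) = lim_{ε→0+} ∫ g(w, x+iεv) f(x) dx` exists for all
`w ∈ U` and `h` is holomorphic on `U`. -/
theorem tube_domain_boundary_value_holomorphic_in_parameter
    (d : ℕ) (hd : 1 ≤ d)
    (V : Set (Fin d → ℝ))
    (hVopen : IsOpen V) (hVne : V.Nonempty) (hV0 : (0 : Fin d → ℝ) ∉ V)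
    (hVcone : ∀ y ∈ V, ∀ y' ∈ V, ∀ l m : ℝ, 0 < l → 0 < m → l • y + m • y' ∈ V)
    (a : ℝ) (ha : 0 < a)
    (U : Set ℂ) (hU : IsOpen U)
    (g : ℂ × (Fin d → ℂ) → ℂ)
    (hg : DifferentiableOn ℂ g
      (U ×ˢ {z : Fin d → ℂ |
        (fun k => (z k).im) ∈ V ∧ Real.sqrt (∑ k, (z k).im ^ 2) < a}))
    (hbound : ∀ 𝒦 : Set ℂ, 𝒦 ⊆ U → IsCompact 𝒦 →
      ∃ C : ℝ, 0 < C ∧ ∃ L K : ℕ, ∀ w ∈ 𝒦, ∀ z : Fin d → ℂ,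
        (fun k => (z k).im) ∈ V → Real.sqrt (∑ k, (z k).im ^ 2) < a →
        ‖g (w, z)‖ ≤ C * (1 + ∑ k, (z k).re ^ 2) ^ L / (∑ k, (z k).im ^ 2) ^ K)
    (v : Fin d → ℝ) (hv : v ∈ V)
    (f : SchwartzMap (Fin d → ℝ) ℂ) :
    ∃ h : ℂ → ℂ,
      (∀ w ∈ U,
        Tendsto
          (fun ε : ℝ => ∫ x : Fin d → ℝ,
            g (w, fun k => (x k : ℂ) + (ε * v k : ℝ) * Complex.I) * f x)
          (nhdsWithin 0 (Set.Ioi 0)) (nhds (h w))) ∧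
      DifferentiableOn ℂ h U := by
  have hv0 : v ≠ 0 := fun h => hV0 (h ▸ hv)
  set S : ℝ := ∑ k, v k ^ 2 with hS
  have hSpos : 0 < S := by
    obtain ⟨k, hk⟩ := Function.ne_iff.1 hv0
    exact Finset.sum_pos' (fun k _ => sq_nonneg _) ⟨k, Finset.mem_univ _, by
      have : v k ≠ 0 := hk
      positivity⟩
  set δ₀ : ℝ := a / Real.sqrt S
  have hδ₀pos : 0 < δ₀ := by positivity
  set W : Set (Fin d → ℂ) := {z : Fin d → ℂ |
    (fun k => (z k).im) ∈ V ∧ Real.sqrt (∑ k, (z k).im ^ 2) < a}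
  set p : (Fin d → ℝ) → ℂ → Fin d → ℂ := fun x ζ k => (x k : ℂ) + ζ * v k with hp
  have hsum : ∀ x ζ, ∑ k, (p x ζ k).im ^ 2 = ζ.im ^ 2 * S := by
    intro x ζ
    simp [hp, hS, Finset.mul_sum, mul_pow]
  have hpW : ∀ x (ζ : ℂ), ζ.im ∈ Set.Ioo 0 δ₀ → p x ζ ∈ W := by
    intro x ζ hζ
    refine ⟨?_, ?_⟩
    · have h2 : ζ.im / 2 + ζ.im / 2 = ζ.im := by ring
      have h := hVcone v hv v hv (ζ.im / 2) (ζ.im / 2) (half_pos hζ.1) (half_pos hζ.1)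
      rw [← add_smul, h2] at h
      convert h using 1
      ext k
      simp [hp]
    · rw [hsum, Real.sqrt_mul (sq_nonneg _), Real.sqrt_sq hζ.1.le]
      exact (lt_div_iff₀ (Real.sqrt_pos.2 hSpos)).1 hζ.2
  have hgrowth : ∀ 𝒦 : Set ℂ, 𝒦 ⊆ U → IsCompact 𝒦 → ∃ C : ℝ, 0 ≤ C ∧ ∃ N M : ℕ,
      ∀ w ∈ 𝒦, ∀ x (ζ : ℂ), ζ.im ∈ Set.Ioo 0 δ₀ →
        ‖g (w, p x ζ)‖ ≤ C * (1 + ‖x + ζ.re • v‖) ^ N / ζ.im ^ M := by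
    intro 𝒦 h𝒦 h𝒦c
    obtain ⟨C, hC, L, K, hb⟩ := hbound 𝒦 h𝒦 h𝒦c
    refine ⟨C * (1 + d) ^ L / S ^ K, by positivity, 2 * L, 2 * K, fun w hw x ζ hζ => ?_⟩
    have hζ0 := hζ.1
    refine (hb w hw (p x ζ) (hpW x ζ hζ).1 (hpW x ζ hζ).2).trans ?_
    have hre : ∀ k, (p x ζ k).re = (x + ζ.re • v) k := fun k => by simp [hp]
    simp_rw [hre]
    rw [hsum]
    calc _ ≤ C * ((1 + d) * (1 + ‖x + ζ.re • v‖) ^ 2) ^ L / (ζ.im ^ 2 * S) ^ K := by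
          gcongr
          exact one_add_sum_sq_le _
      _ = _ := by
          rw [mul_pow, mul_pow, ← pow_mul, ← pow_mul]
          field_simp
  have hpdiff : ∀ x, Differentiable ℂ (p x) := fun x => by fun_prop
  have hgcont : ∀ w ∈ U, ∀ ζ : ℂ, ζ.im ∈ Set.Ioo 0 δ₀ → Continuous fun x => g (w, p x ζ) := by
    intro w hw ζ hζ
    exact hg.continuousOn.comp_continuous (by fun_prop) fun x => ⟨hw, hpW x ζ hζ⟩
  have hgdiff : ∀ w ∈ U, ∀ x,
      DifferentiableOn ℂ (fun ζ => g (w, p x ζ)) {ζ | ζ.im ∈ Set.Ioo 0 δ₀} := by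
    intro w hw x
    exact hg.comp ((differentiable_const w).prodMk (hpdiff x)).differentiableOn
      fun ζ hζ => ⟨hw, hpW x ζ hζ⟩
  have hIm : ∀ t : ℝ, ((t : ℂ) * I).im = t := fun t => by simp
  have hδ : 0 < δ₀ / 2 := by positivity
  have hδlt : δ₀ / 2 < δ₀ := by linarith
  have hrw : ∀ (x : Fin d → ℝ) (t : ℝ),
      (fun k => (x k : ℂ) + (t * v k : ℝ) * I) = p x (t * I) := by
    intro x t
    ext k
    simp only [hp]
    push_cast
    ring
  simp_rw [hrw]
  refine exists_holomorphic_limit_of_lipschitz hU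
    (F := fun t w => ∫ x, g (w, p x (t * I)) * f x) hδ ?_ ?_
  · intro t ht w₀ hw₀
    have ht' : ((t : ℂ) * I).im ∈ Set.Ioo 0 δ₀ := by
      rw [hIm]
      exact ⟨ht.1, ht.2.trans_lt hδlt⟩
    obtain ⟨r, hr, hrU⟩ := Metric.nhds_basis_closedBall.mem_iff.1 (hU.mem_nhds hw₀)
    obtain ⟨C, hC, N, M, hb⟩ := hgrowth _ hrU (isCompact_closedBall w₀ r)
    have hball : Metric.ball w₀ r ⊆ U := Metric.ball_subset_closedBall.trans hrU
    refine (hasDerivAt_integral_of_holomorphic_of_dominated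
      (F := fun w x => g (w, p x (t * I)) * f x)
      (bound := fun x => C / t ^ M * ((1 + ‖x‖) ^ N * ‖f x‖)) hr
      (fun w hw => ((hgcont w (hball hw) _ ht').mul f.continuous).aestronglyMeasurable)
      (fun x => ?_) (fun w hw x => ?_)
      ((f.integrable_one_add_norm_pow_mul volume N).const_mul _)).2.differentiableAt
      |>.differentiableWithinAt
    · refine DifferentiableOn.mul_const ?_ _
      exact hg.comp (differentiable_id.prodMk (differentiable_const _)).differentiableOn
        fun w hw => ⟨hball hw, hpW x _ ht'⟩
    · have h1 := hb w (Metric.ball_subset_closedBall hw) x _ ht'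
      simp only [hIm, re_ofReal_mul, I_re, mul_zero, zero_smul, add_zero] at h1
      rw [norm_mul]
      calc _ ≤ C * (1 + ‖x‖) ^ N / t ^ M * ‖f x‖ := by gcongr
        _ = _ := by ring
  · intro 𝒦 h𝒦 h𝒦c
    obtain ⟨C, hC, N, M, hb⟩ := hgrowth 𝒦 h𝒦 h𝒦c
    set D : 𝓢(Fin d → ℝ, ℂ) → 𝓢(Fin d → ℝ, ℂ) := fun φ => (-I) • ∂_{v} φ
    refine exists_lipschitz_of_derivative_chain (M := M)
      (Φ := fun j w (t : ℝ) => ∫ x, g (w, p x (t * I)) * (D^[j] f) x) ?_ ?_ hδ hδlt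
    · intro w hw j t ht
      simp only [Function.iterate_succ_apply']
      refine hasDerivAt_integral_mul_schwartz_of_strip (G := fun x ζ => g (w, p x ζ))
        (fun x ζ s => ?_) (hgcont w (h𝒦 hw)) (hgdiff w (h𝒦 hw)) hC (hb w hw) _ ht
      congr 2
      ext k
      simp only [hp, Pi.add_apply, Pi.smul_apply, smul_eq_mul]
      push_cast
      ring
    · intro j
      refine ⟨∫ x, C * ((1 + ‖x‖) ^ N * ‖(D^[j] f) x‖), fun w hw t ht => ?_⟩
      have hint := ((D^[j] f).integrable_one_add_norm_pow_mul volume N).const_mul C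
      rw [← integral_div]
      refine norm_integral_le_of_norm_le (hint.div_const _) (Eventually.of_forall fun x => ?_)
      have h1 := hb w hw x (t * I) (by rwa [hIm])
      simp only [hIm, re_ofReal_mul, I_re, mul_zero, zero_smul, add_zero] at h1
      rw [norm_mul]
      calc _ ≤ C * (1 + ‖x‖) ^ N / t ^ M * ‖(D^[j] f) x‖ := by gcongr
        _ = _ := by ring
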